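/- Let C ⊆ ℝ^m and D ⊆ ℝ^n be nonzero closed convex cones, T ∈ ℝ^{ℓ×m}, U ∈ ℝ^{p×n}, and let r ≥ 1 be a real number. Set λ_T := max{ min_{x ∈ C ∩ S^{m−1}} ‖Tx‖, min_{z ∈ S^{ℓ−1}} ‖Proj_C(Tᵀz)‖ } and λ_U := max{ min_{y ∈ D ∩ S^{n−1}} ‖Uy‖, min_{z ∈ S^{p−1}} ‖Proj_D(Uᵀz)‖ }. Then for standard Gaussian matrices G̃ ∈ ℝ^{p×ℓ} and G ∈ ℝ^{n×m}, λ_T^r λ_U^r E[ (‖G̃‖_{TC→UD})^r ] ≤ ‖T‖^r ‖U‖^r E[ (‖G‖_{C→D})^r ], where ‖T‖, ‖U‖ denote operator norms and, since TC := {Tx : x ∈ C} and UD := {Uy : y ∈ D} need not be closed, the restricted norm of B ∈ ℝ^{p×ℓ} to arbitrary convex cones K ⊆ ℝ^ℓ, K' ⊆ ℝ^p is taken as ‖B‖_{K→K'} := sup{ ⟨Bx, y⟩ : x ∈ K ∩ B^ℓ, y ∈ K' ∩ B^p }. (Equivalently: E[(‖G̃‖_{TC→UD})^r] ≤ ℛ_C(T)^r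 ℛ_D(U)^r E[(‖G‖_{C→D})^r] with Renegar condition numbers ℛ_C(T) = ‖T‖/λ_T, ℛ_D(U) = ‖U‖/λ_U whenever λ_T, λ_U > 0.) -/

import Mathlib

open MeasureTheory ProbabilityTheory Metric Set
open scoped InnerProductSpace
open scoped Classical
open scoped Pointwise

noncomputable section

/-- Euclidean space `ℝ^k`. -/
abbrev Euc (k : ℕ) : Type := EuclideanSpace ℝ (Fin k)

/-- The linear action of a matrix `A ∈ ℝ^{n×m}` on Euclidean space, `x ↦ Ax`. -/
def mulE {m n : ℕ} (A : Matrix (Fin n) (Fin m) ℝ) (x : Euc m) : Euc n :=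
  Matrix.toEuclideanLin A x

/-- The metric projection onto a set `S`: the point of `S` closest to `y`
(if a unique closest point characterizing property holds; junk value `0` otherwise). -/
def metricProj {k : ℕ} (S : Set (Euc k)) (y : Euc k) : Euc k :=
  if h : ∃ z, z ∈ S ∧ ∀ w ∈ S, dist y z ≤ dist y w then h.choose else 0

/-- `C` is a closed convex cone (containing the origin). -/
def IsClosedConvexCone {k : ℕ} (C : Set (Euc k)) : Prop :=
  IsClosed C ∧ Convex ℝ C ∧ (∀ c : ℝ, 0 ≤ c → ∀ x ∈ C, c • x ∈ C) ∧ (0 : Euc k) ∈ C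

/-- The polar cone `S° = {z | ⟨x,z⟩ ≤ 0 ∀ x ∈ S}`. -/
def polarCone {k : ℕ} (S : Set (Euc k)) : Set (Euc k) :=
  {z | ∀ x ∈ S, ⟪x, z⟫_ℝ ≤ 0}

/-- The restricted norm `‖A‖_{C→D} = max_{x ∈ C ∩ S^{m-1}} ‖Proj_D (Ax)‖`. -/
def resNorm {m n : ℕ} (C : Set (Euc m)) (D : Set (Euc n)) (A : Matrix (Fin n) (Fin m) ℝ) : ℝ :=
  sSup ((fun x => ‖metricProj D (mulE A x)‖) '' (C ∩ sphere 0 1))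

/-- The restricted singular value `σ_{C→D}(A) = min_{x ∈ C ∩ S^{m-1}} ‖Proj_D (Ax)‖`. -/
def resSval {m n : ℕ} (C : Set (Euc m)) (D : Set (Euc n)) (A : Matrix (Fin n) (Fin m) ℝ) : ℝ :=
  sInf ((fun x => ‖metricProj D (mulE A x)‖) '' (C ∩ sphere 0 1))

/-- The restricted norm for arbitrary (not necessarily closed) cones:
`‖B‖_{K→K'} = sup { ⟨Bx, y⟩ : x ∈ K ∩ B^ℓ, y ∈ K' ∩ B^p }`. -/
def resNormGen {l p : ℕ} (K : Set (Euc l)) (K' : Set (Euc p))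
    (B : Matrix (Fin p) (Fin l) ℝ) : ℝ :=
  sSup (Set.image2 (fun x y => ⟪mulE B x, y⟫_ℝ) (K ∩ closedBall 0 1) (K' ∩ closedBall 0 1))

/-- The operator (spectral) norm of a matrix. -/
def opNorm {m n : ℕ} (A : Matrix (Fin n) (Fin m) ℝ) : ℝ :=
  ‖LinearMap.toContinuousLinearMap (Matrix.toEuclideanLin A)‖

/-- The standard Gaussian measure on `ℝ^k` (i.i.d. N(0,1) coordinates). -/
def stdGaussianE (k : ℕ) : Measure (Euc k) :=
  Measure.map (⇑(EuclideanSpace.equiv (Fin k) ℝ).symm)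
    (Measure.pi fun _ : Fin k => gaussianReal 0 1)

/-- The standard Gaussian measure on `n × m` arrays (i.i.d. N(0,1) entries). -/
def stdGaussianPi (n m : ℕ) : Measure (Fin n → Fin m → ℝ) :=
  Measure.pi fun _ : Fin n => Measure.pi fun _ : Fin m => gaussianReal 0 1

/-- The support function `h_K(x) = sup_{z ∈ K} ⟨x, z⟩`. -/
def suppFn {k : ℕ} (K : Set (Euc k)) (x : Euc k) : ℝ := sSup ((fun z => ⟪x, z⟫_ℝ) '' K)

/-- The capped-angle cosine `cos d̄(X,Y) = max{⟨x,y⟩ : x ∈ X ∩ B, y ∈ Y ∩ B}`. -/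
def cosAng {k : ℕ} (X Y : Set (Euc k)) : ℝ :=
  sSup (Set.image2 (fun x y => ⟪x, y⟫_ℝ) (X ∩ closedBall 0 1) (Y ∩ closedBall 0 1))

/-- `sin d̄(X,Y) = √(1 - cos d̄(X,Y)²)`. -/
def sinAng {k : ℕ} (X Y : Set (Euc k)) : ℝ := Real.sqrt (1 - cosAng X Y ^ 2)

/-- The Kronecker (tensor) product `x ⊗ y ∈ ℝ^{mn}`. -/
def kron {m n : ℕ} (x : Euc m) (y : Euc n) : EuclideanSpace ℝ (Fin m × Fin n) :=
  (EuclideanSpace.equiv (Fin m × Fin n) ℝ).symm (fun p => x p.1 * y p.2)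

/-- The primal feasible set `𝒫(C,D) = {A | ∃ x ∈ C \ {0}, Ax ∈ D°}`. -/
def primalSet {m n : ℕ} (C : Set (Euc m)) (D : Set (Euc n)) :
    Set (Matrix (Fin n) (Fin m) ℝ) :=
  {A | ∃ x ∈ C, x ≠ 0 ∧ mulE A x ∈ polarCone D}

/-- The dual feasible set `𝒟(C,D) = {A | ∃ y ∈ D \ {0}, -Aᵀy ∈ C°}`. -/
def dualSet {m n : ℕ} (C : Set (Euc m)) (D : Set (Euc n)) :
    Set (Matrix (Fin n) (Fin m) ℝ) :=
  {A | ∃ y ∈ D, y ≠ 0 ∧ -(mulE A.transpose y) ∈ polarCone C}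

/-- `K₂` is a `0`-contraction of `K₁`: there are generating sets `M₁` of `K₁`, `M₂` of `K₂`
(i.e. `Kᵢ` is the closed convex hull of `Mᵢ`) and a surjection `φ : M₁ → M₂` that is
`1`-Lipschitz and norm-nonincreasing. -/
def IsZeroContractionOf {E₁ E₂ : Type*} [NormedAddCommGroup E₁] [NormedSpace ℝ E₁]
    [NormedAddCommGroup E₂] [NormedSpace ℝ E₂] (K₁ : Set E₁) (K₂ : Set E₂) : Prop :=
  ∃ (M₁ : Set E₁) (M₂ : Set E₂) (φ : E₁ → E₂),
    closure (convexHull ℝ M₁) = K₁ ∧ closure (convexHull ℝ M₂) = K₂ ∧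
    φ '' M₁ = M₂ ∧
    (∀ x ∈ M₁, ∀ x' ∈ M₁, ‖φ x - φ x'‖ ≤ ‖x - x'‖) ∧
    (∀ x ∈ M₁, ‖φ x‖ ≤ ‖x‖)

/-- The pair `(x, y)` regarded as an element of the Euclidean (ℓ²) product. -/
def pairL2 {m n : ℕ} (x : Euc m) (y : Euc n) : WithLp 2 (Euc m × Euc n) :=
  (WithLp.equiv 2 (Euc m × Euc n)).symm (x, y)

/-- The product `K × K'` as a subset of the Euclidean (ℓ²) product space. -/
def prodL2 {m n : ℕ} (K : Set (Euc m)) (K' : Set (Euc n)) : Set (WithLp 2 (Euc m × Euc n)) :=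
  {q | ((WithLp.equiv 2 (Euc m × Euc n)) q).1 ∈ K ∧ ((WithLp.equiv 2 (Euc m × Euc n)) q).2 ∈ K'}


section Gaussian

variable {E F F' : Type*}
  [NormedAddCommGroup E] [InnerProductSpace ℝ E] [FiniteDimensional ℝ E]
  [NormedAddCommGroup F] [InnerProductSpace ℝ F] [FiniteDimensional ℝ F]
  [NormedAddCommGroup F'] [InnerProductSpace ℝ F'] [FiniteDimensional ℝ F']

/-- A positive semidefinite defect `c² - L L†` has a square root. -/
lemma exists_adjoint_norm_sq_eq (L : E →L[ℝ] F) (c : ℝ) (h : ∀ x, ‖L x‖ ≤ c * ‖x‖) (hc : 0 ≤ c) :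
    ∃ S : F →L[ℝ] F, ∀ t, ‖L.adjoint t‖ ^ 2 + ‖S.adjoint t‖ ^ 2 = c ^ 2 * ‖t‖ ^ 2 := by
  have hadj : ∀ t, ‖L.adjoint t‖ ≤ c * ‖t‖ := fun t => by
    refine (L.adjoint.le_opNorm t).trans ?_
    rw [LinearIsometryEquiv.norm_map]
    gcongr
    exact L.opNorm_le_bound hc h
  let P : F →L[ℝ] F := c ^ 2 • ContinuousLinearMap.id ℝ F - L ∘L L.adjoint
  have hPin : ∀ s t, ⟪P s, t⟫_ℝ = c ^ 2 * ⟪s, t⟫_ℝ - ⟪L.adjoint s, L.adjoint t⟫_ℝ := by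
    intro s t
    simp [P, inner_sub_left, real_inner_smul_left, ContinuousLinearMap.adjoint_inner_right]
  have hsymm : (P : F →ₗ[ℝ] F).IsSymmetric := by
    intro s t
    simp only [ContinuousLinearMap.coe_coe]
    rw [real_inner_comm (P t) s, hPin, hPin, real_inner_comm s t,
      real_inner_comm (L.adjoint s)]
  let b := hsymm.eigenvectorBasis rfl
  let ev := hsymm.eigenvalues rfl
  have hev : ∀ i, 0 ≤ ev i := by
    intro i
    have h1 : ⟪P (b i), b i⟫_ℝ = ev i := by
      have := hsymm.apply_eigenvectorBasis rfl i
      simp only [ContinuousLinearMap.coe_coe] at this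
      simp [b, ev, this, real_inner_smul_left]
    rw [← h1, hPin, real_inner_self_eq_norm_sq, real_inner_self_eq_norm_sq, ← mul_pow,
      sub_nonneg]
    exact pow_le_pow_left₀ (norm_nonneg _) (hadj _) 2
  let R : F →L[ℝ] F := ∑ i, (Real.sqrt (ev i) • innerSL ℝ (b i)).smulRight (b i)
  refine ⟨R.adjoint, fun t => ?_⟩
  rw [ContinuousLinearMap.adjoint_adjoint]
  have hR : ‖R t‖ ^ 2 = ⟪P t, t⟫_ℝ := by
    have h1 : ∀ i, ⟪b i, R t⟫_ℝ = Real.sqrt (ev i) * ⟪b i, t⟫_ℝ := by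
      intro i
      simp [R, inner_sum, real_inner_smul_right, orthonormal_iff_ite.1 b.orthonormal]
    have h2 : ∀ i, ⟪b i, P t⟫_ℝ = ev i * ⟪b i, t⟫_ℝ := by
      intro i
      have h3 := hsymm (b i) t
      have := hsymm.apply_eigenvectorBasis rfl i
      simp only [ContinuousLinearMap.coe_coe] at this h3
      rw [← h3]
      simp [b, ev, this, real_inner_smul_left]
    rw [← b.sum_sq_inner_right, ← b.sum_inner_mul_inner (P t) t]
    refine Finset.sum_congr rfl fun i _ => ?_
    rw [h1, real_inner_comm (b i) (P t), h2, mul_pow, Real.sq_sqrt (hev i)]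
    ring
  rw [hR, hPin, real_inner_self_eq_norm_sq, real_inner_self_eq_norm_sq]
  ring

variable [MeasurableSpace E] [BorelSpace E] [MeasurableSpace F] [BorelSpace F]
  [MeasurableSpace F'] [BorelSpace F']

/-- Transformation of characteristic functions under a continuous linear map. -/
lemma charFun_map_continuousLinearMap (μ : Measure E) (L : E →L[ℝ] F) (t : F) :
    charFun (μ.map L) t = charFun μ (L.adjoint t) := by
  rw [charFun_apply, charFun_apply, integral_map (by fun_prop) (by fun_prop)]
  simp_rw [ContinuousLinearMap.adjoint_inner_right]

/-- The sum of two independent linear images of standard Gaussians is a scaled standard Gaussian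
as soon as the covariances add up to a multiple of the identity. -/
lemma map_prod_stdGaussian_eq (L : E →L[ℝ] F) (S : F' →L[ℝ] F) (c : ℝ)
    (h : ∀ t, ‖L.adjoint t‖ ^ 2 + ‖S.adjoint t‖ ^ 2 = c ^ 2 * ‖t‖ ^ 2) :
    ((stdGaussian E).prod (stdGaussian F')).map (fun q => L q.1 + S q.2)
      = (stdGaussian F).map (fun x => c • x) := by
  have hLp : IsProbabilityMeasure ((stdGaussian E).map L) :=
    Measure.isProbabilityMeasure_map (by fun_prop)
  have hSp : IsProbabilityMeasure ((stdGaussian F').map S) :=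
    Measure.isProbabilityMeasure_map (by fun_prop)
  have h1 : ((stdGaussian E).prod (stdGaussian F')).map (fun q => L q.1 + S q.2)
      = (((stdGaussian E).map L).prod ((stdGaussian F').map S)).map (fun p => p.1 + p.2) := by
    rw [Measure.map_prod_map _ _ (by fun_prop) (by fun_prop),
      Measure.map_map (by fun_prop) (by fun_prop)]
    rfl
  rw [h1]
  apply Measure.ext_of_charFun
  ext t
  rw [charFun_map_add_prod_eq_mul, Pi.mul_apply, charFun_map_continuousLinearMap,
    charFun_map_continuousLinearMap, charFun_map_smul]
  simp_rw [charFun_stdGaussian]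
  rw [← Complex.exp_add, norm_smul, ← add_div, ← neg_add]
  congr 3
  rw [Real.norm_eq_abs]
  norm_cast
  rw [h, mul_pow, sq_abs]

/-- Convex functions have a larger mean under a Gaussian with larger covariance. -/
lemma integral_comp_stdGaussian_le (L : E →L[ℝ] F) (c : ℝ) (h : ∀ x, ‖L x‖ ≤ c * ‖x‖)
    (hc : 0 ≤ c) (f : F → ℝ) (hf : ConvexOn ℝ univ f)
    (hfc : Continuous f) (hfi : Integrable (fun x => f (c • x)) (stdGaussian F))
    (hLi : Integrable (fun x => f (L x)) (stdGaussian E)) :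
    ∫ x, f (L x) ∂(stdGaussian E) ≤ ∫ x, f (c • x) ∂(stdGaussian F) := by
  obtain ⟨S, hS⟩ := exists_adjoint_norm_sq_eq L c h hc
  have hplus := map_prod_stdGaussian_eq L S c hS
  have hminus := map_prod_stdGaussian_eq L (-S) c (by simpa using hS)
  have hfi' : Integrable f ((stdGaussian F).map (fun x => c • x)) :=
    (integrable_map_measure hfc.aestronglyMeasurable (by fun_prop)).2 hfi
  have hmp : Measurable fun q : E × F => L q.1 + S q.2 := by fun_prop
  have hmm : Measurable fun q : E × F => L q.1 + (-S) q.2 := by fun_prop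
  have ip : Integrable (fun q : E × F => f (L q.1 + S q.2)) _ :=
    (integrable_map_measure hfc.aestronglyMeasurable hmp.aemeasurable).1 (hplus ▸ hfi')
  have im : Integrable (fun q : E × F => f (L q.1 + (-S) q.2)) _ :=
    (integrable_map_measure hfc.aestronglyMeasurable hmm.aemeasurable).1 (hminus ▸ hfi')
  have ep : ∫ q, f (L q.1 + S q.2) ∂((stdGaussian E).prod (stdGaussian F))
      = ∫ x, f (c • x) ∂(stdGaussian F) := by
    rw [← integral_map hmp.aemeasurable hfc.aestronglyMeasurable, hplus,
      integral_map (by fun_prop) hfc.aestronglyMeasurable]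
  have em : ∫ q, f (L q.1 + (-S) q.2) ∂((stdGaussian E).prod (stdGaussian F))
      = ∫ x, f (c • x) ∂(stdGaussian F) := by
    rw [← integral_map hmm.aemeasurable hfc.aestronglyMeasurable, hminus,
      integral_map (by fun_prop) hfc.aestronglyMeasurable]
  have e0 : ∫ q, f (L q.1) ∂((stdGaussian E).prod (stdGaussian F))
      = ∫ x, f (L x) ∂(stdGaussian E) := by
    rw [integral_fun_fst (fun x => f (L x))]
    simp
  calc ∫ x, f (L x) ∂(stdGaussian E)
      = ∫ q, f (L q.1) ∂((stdGaussian E).prod (stdGaussian F)) := e0.symm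
    _ ≤ ∫ q, ((1 / 2 : ℝ) * f (L q.1 + S q.2) + (1 / 2 : ℝ) * f (L q.1 + (-S) q.2))
          ∂((stdGaussian E).prod (stdGaussian F)) := by
        refine integral_mono (hLi.comp_fst _) ((ip.const_mul _).add (im.const_mul _)) fun q => ?_
        have := hf.2 (mem_univ (L q.1 + S q.2)) (mem_univ (L q.1 + (-S) q.2))
          (by norm_num : (0 : ℝ) ≤ 1 / 2) (by norm_num : (0 : ℝ) ≤ 1 / 2) (by norm_num)
        have he : (1 / 2 : ℝ) • (L q.1 + S q.2) + (1 / 2 : ℝ) • (L q.1 + (-S) q.2) = L q.1 := by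
          simp only [_root_.neg_apply]
          module
        rw [he] at this
        simpa [smul_eq_mul] using this
    _ = ∫ x, f (c • x) ∂(stdGaussian F) := by
        rw [integral_add (ip.const_mul _) (im.const_mul _), integral_const_mul,
          integral_const_mul, ep, em]
        ring

end Gaussian

section Cones

variable {m n l p : ℕ}

lemma mulE_add_smul (A B : Matrix (Fin n) (Fin m) ℝ) (a b : ℝ) (x : Euc m) :
    mulE (a • A + b • B) x = a • mulE A x + b • mulE B x := by
  simp [mulE]

lemma mulE_matrix_smul (A : Matrix (Fin n) (Fin m) ℝ) (a : ℝ) (x : Euc m) :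
    mulE (a • A) x = a • mulE A x := by
  simp [mulE]

lemma mulE_smul (A : Matrix (Fin n) (Fin m) ℝ) (a : ℝ) (x : Euc m) :
    mulE A (a • x) = a • mulE A x := by
  simp [mulE]

lemma mulE_zero (A : Matrix (Fin n) (Fin m) ℝ) : mulE A 0 = 0 := by
  simp [mulE]

lemma mulE_mul (A : Matrix (Fin n) (Fin m) ℝ) (B : Matrix (Fin m) (Fin l) ℝ) (x : Euc l) :
    mulE (A * B) x = mulE A (mulE B x) := by
  simp [mulE, Matrix.toLpLin_mul_same]

lemma inner_mulE (A : Matrix (Fin n) (Fin m) ℝ) (x : Euc m) (y : Euc n) :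
    ⟪mulE A x, y⟫_ℝ = ⟪x, mulE A.transpose y⟫_ℝ := by
  rw [mulE, mulE, ← Matrix.conjTranspose_eq_transpose_of_trivial,
    Matrix.toEuclideanLin_conjTranspose_eq_adjoint, LinearMap.adjoint_inner_right]

lemma norm_mulE_le (A : Matrix (Fin n) (Fin m) ℝ) (x : Euc m) :
    ‖mulE A x‖ ≤ opNorm A * ‖x‖ :=
  (LinearMap.toContinuousLinearMap (Matrix.toEuclideanLin A)).le_opNorm x

lemma opNorm_nonneg (A : Matrix (Fin n) (Fin m) ℝ) : 0 ≤ opNorm A := norm_nonneg _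

lemma norm_mulE_transpose_le (A : Matrix (Fin n) (Fin m) ℝ) (z : Euc n) :
    ‖mulE A.transpose z‖ ≤ opNorm A * ‖z‖ := by
  rcases (norm_nonneg (mulE A.transpose z)).eq_or_lt with h | h
  · rw [← h]
    exact mul_nonneg (opNorm_nonneg A) (norm_nonneg z)
  · refine le_of_mul_le_mul_right ?_ h
    calc ‖mulE A.transpose z‖ * ‖mulE A.transpose z‖
        = ⟪mulE A (mulE A.transpose z), z⟫_ℝ := by rw [inner_mulE, real_inner_self_eq_norm_mul_norm]
      _ ≤ ‖mulE A (mulE A.transpose z)‖ * ‖z‖ := real_inner_le_norm _ _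
      _ ≤ opNorm A * ‖mulE A.transpose z‖ * ‖z‖ := by gcongr; exact norm_mulE_le _ _
      _ = opNorm A * ‖z‖ * ‖mulE A.transpose z‖ := by ring

/-- The Moreau characterization of the projection onto a closed convex cone. -/
lemma metricProj_spec {D : Set (Euc n)} (hD : IsClosedConvexCone D) (v : Euc n) :
    metricProj D v ∈ D ∧ ⟪v - metricProj D v, metricProj D v⟫_ℝ = 0 ∧
      ∀ w ∈ D, ⟪v - metricProj D v, w⟫_ℝ ≤ 0 := by
  obtain ⟨hcl, hcv, hsm, h0⟩ := hD
  have hex : ∃ z, z ∈ D ∧ ∀ w ∈ D, dist v z ≤ dist v w := by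
    obtain ⟨z, hz, he⟩ := hcl.exists_infDist_eq_dist ⟨0, h0⟩ v
    exact ⟨z, hz, fun w hw => he ▸ infDist_le_dist_of_mem hw⟩
  have hP : metricProj D v ∈ D ∧ ∀ w ∈ D, dist v (metricProj D v) ≤ dist v w := by
    rw [metricProj, dif_pos hex]
    exact hex.choose_spec
  set q := metricProj D v
  obtain ⟨hq, hmin⟩ := hP
  have hvar : ∀ w ∈ D, ⟪v - q, w - q⟫_ℝ ≤ 0 := by
    refine (norm_eq_iInf_iff_real_inner_le_zero hcv hq).1 ?_
    have : Nonempty D := ⟨⟨0, h0⟩⟩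
    refine le_antisymm (le_ciInf fun w => ?_) ?_
    · simpa [dist_eq_norm] using hmin w w.2
    · exact ciInf_le (f := fun w : D => ‖v - w‖)
        ⟨0, by rintro _ ⟨w, rfl⟩; exact norm_nonneg _⟩ ⟨q, hq⟩
  have h1 := hvar 0 h0
  have h2 := hvar ((2 : ℝ) • q) (hsm 2 (by norm_num) q hq)
  rw [zero_sub, inner_neg_right] at h1
  rw [two_smul, add_sub_cancel_right] at h2
  have h3 : ⟪v - q, q⟫_ℝ = 0 := by linarith
  refine ⟨hq, h3, fun w hw => ?_⟩
  have := hvar w hw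
  rw [inner_sub_right, h3] at this
  linarith

lemma inner_le_norm_metricProj {D : Set (Euc n)} (hD : IsClosedConvexCone D) (v : Euc n)
    {y : Euc n} (hy : y ∈ D) (hy1 : ‖y‖ ≤ 1) : ⟪v, y⟫_ℝ ≤ ‖metricProj D v‖ := by
  have h := (metricProj_spec hD v).2.2 y hy
  rw [inner_sub_left] at h
  have h2 := real_inner_le_norm (metricProj D v) y
  nlinarith [norm_nonneg (metricProj D v)]

lemma exists_inner_eq_norm_metricProj {D : Set (Euc n)} (hD : IsClosedConvexCone D)
    (v : Euc n) : ∃ y ∈ D, ‖y‖ ≤ 1 ∧ ⟪v, y⟫_ℝ = ‖metricProj D v‖ := by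
  obtain ⟨hq, h0, -⟩ := metricProj_spec hD v
  by_cases hz : metricProj D v = 0
  · exact ⟨0, hD.2.2.2, by simp, by simp [hz]⟩
  · have hn : ‖metricProj D v‖ ≠ 0 := norm_ne_zero_iff.2 hz
    refine ⟨‖metricProj D v‖⁻¹ • metricProj D v, hD.2.2.1 _ (by positivity) _ hq, ?_, ?_⟩
    · rw [norm_smul, norm_inv, norm_norm, inv_mul_cancel₀ hn]
    · rw [inner_sub_left, real_inner_self_eq_norm_mul_norm, sub_eq_zero] at h0
      rw [real_inner_smul_right, h0]
      field_simp

lemma exists_mem_cone_sphere {C : Set (Euc m)} (hC : IsClosedConvexCone C) {x : Euc m}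
    (hx : x ∈ C) (hx0 : x ≠ 0) : ‖x‖⁻¹ • x ∈ C ∩ sphere (0 : Euc m) 1 := by
  refine ⟨hC.2.2.1 _ (by positivity) _ hx, ?_⟩
  rw [mem_sphere_zero_iff_norm, norm_smul, norm_inv, norm_norm,
    inv_mul_cancel₀ (norm_ne_zero_iff.2 hx0)]

lemma inner_mulE_le_opNorm (A : Matrix (Fin n) (Fin m) ℝ) {x : Euc m} {y : Euc n}
    (hx : ‖x‖ ≤ 1) (hy : ‖y‖ ≤ 1) : ⟪mulE A x, y⟫_ℝ ≤ opNorm A := by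
  have h0 := opNorm_nonneg A
  calc ⟪mulE A x, y⟫_ℝ ≤ ‖mulE A x‖ * ‖y‖ := real_inner_le_norm _ _
    _ ≤ (opNorm A * 1) * 1 := by
      gcongr
      exact (norm_mulE_le A x).trans (by gcongr)
    _ = opNorm A := by ring

lemma inner_le_resNormGen {K : Set (Euc m)} {K' : Set (Euc n)} (A : Matrix (Fin n) (Fin m) ℝ)
    {x : Euc m} {y : Euc n} (hx : x ∈ K) (hx1 : ‖x‖ ≤ 1) (hy : y ∈ K') (hy1 : ‖y‖ ≤ 1) :
    ⟪mulE A x, y⟫_ℝ ≤ resNormGen K K' A := by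
  refine le_csSup ⟨opNorm A, ?_⟩ ⟨x, ⟨hx, by simpa using hx1⟩, y, ⟨hy, by simpa using hy1⟩, rfl⟩
  rintro _ ⟨x, ⟨-, hx⟩, y, ⟨-, hy⟩, rfl⟩
  exact inner_mulE_le_opNorm A (by simpa using hx) (by simpa using hy)

lemma resNormGen_le {K : Set (Euc m)} {K' : Set (Euc n)} (hK : 0 ∈ K) (hK' : 0 ∈ K')
    {A : Matrix (Fin n) (Fin m) ℝ} {c : ℝ}
    (h : ∀ x ∈ K, ‖x‖ ≤ 1 → ∀ y ∈ K', ‖y‖ ≤ 1 → ⟪mulE A x, y⟫_ℝ ≤ c) :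
    resNormGen K K' A ≤ c := by
  refine csSup_le ⟨_, 0, ⟨hK, by simp⟩, 0, ⟨hK', by simp⟩, rfl⟩ ?_
  rintro _ ⟨x, ⟨hx, hx1⟩, y, ⟨hy, hy1⟩, rfl⟩
  exact h x hx (by simpa using hx1) y hy (by simpa using hy1)

lemma resNormGen_nonneg {K : Set (Euc m)} {K' : Set (Euc n)} (hK : 0 ∈ K) (hK' : 0 ∈ K')
    (A : Matrix (Fin n) (Fin m) ℝ) : 0 ≤ resNormGen K K' A := by
  simpa using inner_le_resNormGen A hK (by simp) hK' (by simp)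

/-- For closed convex cones the projection form of the restricted norm agrees with the
bilinear form. -/
lemma resNorm_eq_resNormGen {C : Set (Euc m)} {D : Set (Euc n)} (hC : IsClosedConvexCone C)
    (hD : IsClosedConvexCone D) (A : Matrix (Fin n) (Fin m) ℝ) :
    resNorm C D A = resNormGen C D A := by
  have hub : ∀ x ∈ C ∩ sphere (0 : Euc m) 1,
      ‖metricProj D (mulE A x)‖ ≤ resNormGen C D A := by
    rintro x ⟨hx, hx1⟩
    obtain ⟨y, hy, hy1, he⟩ := exists_inner_eq_norm_metricProj hD (mulE A x)
    rw [← he]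
    exact inner_le_resNormGen A hx (by simp at hx1; simp [hx1]) hy hy1
  have hnn : 0 ≤ resNorm C D A :=
    Real.sSup_nonneg (by rintro _ ⟨x, -, rfl⟩; exact norm_nonneg _)
  refine le_antisymm ?_ (resNormGen_le hC.2.2.2 hD.2.2.2 fun x hx hx1 y hy hy1 => ?_)
  · refine Real.sSup_le ?_ (resNormGen_nonneg hC.2.2.2 hD.2.2.2 A)
    rintro _ ⟨x, hx, rfl⟩
    exact hub x hx
  · by_cases hx0 : x = 0
    · simpa [hx0, mulE_zero] using hnn
    · have hmem := exists_mem_cone_sphere hC hx hx0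
      have h1 : ‖metricProj D (mulE A (‖x‖⁻¹ • x))‖ ≤ resNorm C D A :=
        le_csSup ⟨resNormGen C D A, by rintro _ ⟨z, hz, rfl⟩; exact hub z hz⟩ ⟨_, hmem, rfl⟩
      have h2 := inner_le_norm_metricProj hD (mulE A (‖x‖⁻¹ • x)) hy hy1
      have hn : 0 < ‖x‖ := norm_pos_iff.2 hx0
      rw [mulE_smul, real_inner_smul_left, ← mulE_smul, inv_mul_eq_div, div_le_iff₀ hn] at h2
      nlinarith [norm_nonneg (metricProj D (mulE A (‖x‖⁻¹ • x)))]

lemma resNormGen_add_smul_le {K : Set (Euc m)} {K' : Set (Euc n)} (hK : 0 ∈ K) (hK' : 0 ∈ K')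
    (A B : Matrix (Fin n) (Fin m) ℝ) {a b : ℝ} (ha : 0 ≤ a) (hb : 0 ≤ b) :
    resNormGen K K' (a • A + b • B) ≤ a * resNormGen K K' A + b * resNormGen K K' B := by
  refine resNormGen_le hK hK' fun x hx hx1 y hy hy1 => ?_
  rw [mulE_add_smul, inner_add_left, real_inner_smul_left, real_inner_smul_left]
  gcongr <;> exact inner_le_resNormGen _ hx hx1 hy hy1

lemma resNormGen_smul_le {K : Set (Euc m)} {K' : Set (Euc n)} (hK : 0 ∈ K) (hK' : 0 ∈ K')
    (A : Matrix (Fin n) (Fin m) ℝ) {a : ℝ} (ha : 0 ≤ a) :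
    resNormGen K K' (a • A) ≤ a * resNormGen K K' A := by
  refine resNormGen_le hK hK' fun x hx hx1 y hy hy1 => ?_
  rw [mulE_matrix_smul, real_inner_smul_left]
  gcongr
  exact inner_le_resNormGen _ hx hx1 hy hy1

/-- If `z ↦ ‖Proj_C (Tᵀ z)‖` is bounded below by `c` on the sphere, then the image under `T` of the
unit ball of `C` contains the ball of radius `c`. -/
lemma exists_mulE_eq_of_le_norm_metricProj {C : Set (Euc m)} (hC : IsClosedConvexCone C)
    (T : Matrix (Fin l) (Fin m) ℝ) {c : ℝ}
    (h : ∀ z ∈ sphere (0 : Euc l) 1, c ≤ ‖metricProj C (mulE T.transpose z)‖)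
    {w : Euc l} (hw : ‖w‖ ≤ c) : ∃ x ∈ C, ‖x‖ ≤ 1 ∧ mulE T x = w := by
  by_contra hcon
  have hcont : Continuous (mulE T) := (Matrix.toEuclideanLin T).continuous_of_finiteDimensional
  have hcpt : IsCompact (mulE T '' (C ∩ closedBall 0 1)) :=
    ((isCompact_closedBall (0 : Euc m) 1).inter_left hC.1).image hcont
  have hconv : Convex ℝ (mulE T '' (C ∩ closedBall 0 1)) :=
    (hC.2.1.inter (convex_closedBall _ _)).linear_image (Matrix.toEuclideanLin T)
  have hnot : w ∉ mulE T '' (C ∩ closedBall 0 1) := by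
    rintro ⟨x, ⟨hx, hx1⟩, he⟩
    exact hcon ⟨x, hx, by simpa using hx1, he⟩
  obtain ⟨f, u, hfu, huw⟩ := geometric_hahn_banach_closed_point hconv hcpt.isClosed hnot
  let z : Euc l := (InnerProductSpace.toDual ℝ (Euc l)).symm f
  have hz : ∀ v, f v = ⟪z, v⟫_ℝ := fun v => by simp [z]
  have hu : 0 < u := by
    simpa using hfu 0 ⟨0, ⟨hC.2.2.2, by simp⟩, mulE_zero T⟩
  have hz0 : z ≠ 0 := by
    intro h0
    rw [hz, h0, inner_zero_left] at huw
    linarith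
  have hzn : 0 < ‖z‖ := norm_pos_iff.2 hz0
  have hs : ‖z‖⁻¹ • z ∈ sphere (0 : Euc l) 1 := by
    rw [mem_sphere_zero_iff_norm, norm_smul, norm_inv, norm_norm, inv_mul_cancel₀ hzn.ne']
  obtain ⟨x, hx, hx1, he⟩ := exists_inner_eq_norm_metricProj hC (mulE T.transpose (‖z‖⁻¹ • z))
  have h1 := h _ hs
  rw [← he, mulE_smul, real_inner_smul_left, real_inner_comm, ← inner_mulE, real_inner_comm,
    ← hz, inv_mul_eq_div, le_div_iff₀ hzn] at h1
  have h2 := hfu _ ⟨x, ⟨hx, by simpa using hx1⟩, rfl⟩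
  have h3 := real_inner_le_norm z w
  rw [← hz] at h3
  nlinarith

/-- The condition parameter `lam` of `T` satisfies `lam • (T C ∩ B) ⊆ T (C ∩ B)`. -/
lemma exists_mulE_eq_smul {C : Set (Euc m)} (hC : IsClosedConvexCone C)
    (T : Matrix (Fin l) (Fin m) ℝ) {lam : ℝ}
    (hlam : lam = max (sInf ((fun x => ‖mulE T x‖) '' (C ∩ sphere (0 : Euc m) 1)))
        (sInf ((fun z => ‖metricProj C (mulE T.transpose z)‖) '' sphere (0 : Euc l) 1))) :
    0 ≤ lam ∧ ∀ x ∈ C, ‖mulE T x‖ ≤ 1 → ∃ x' ∈ C, ‖x'‖ ≤ 1 ∧ mulE T x' = lam • mulE T x := by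
  have hlam0 : 0 ≤ lam := by
    rw [hlam]
    exact le_max_of_le_left (Real.sInf_nonneg (by rintro _ ⟨x, -, rfl⟩; exact norm_nonneg _))
  refine ⟨hlam0, fun x hx hx1 => ?_⟩
  rcases max_choice (sInf ((fun x => ‖mulE T x‖) '' (C ∩ sphere (0 : Euc m) 1)))
      (sInf ((fun z => ‖metricProj C (mulE T.transpose z)‖) '' sphere (0 : Euc l) 1)) with hm | hm
  · rw [hm] at hlam
    refine ⟨lam • x, hC.2.2.1 _ hlam0 _ hx, ?_, mulE_smul T lam x⟩
    by_cases hx0 : x = 0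
    · simp [hx0]
    have hn : 0 < ‖x‖ := norm_pos_iff.2 hx0
    have h1 : lam ≤ ‖mulE T (‖x‖⁻¹ • x)‖ := by
      rw [hlam]
      exact csInf_le ⟨0, by rintro _ ⟨x, -, rfl⟩; exact norm_nonneg _⟩
        ⟨_, exists_mem_cone_sphere hC hx hx0, rfl⟩
    rw [mulE_smul, norm_smul, norm_inv, norm_norm, inv_mul_eq_div, le_div_iff₀ hn] at h1
    rw [norm_smul, Real.norm_of_nonneg hlam0]
    exact h1.trans hx1
  · rw [hm] at hlam
    refine exists_mulE_eq_of_le_norm_metricProj hC T (c := lam) (fun z hz => ?_) ?_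
    · rw [hlam]
      exact csInf_le ⟨0, by rintro _ ⟨x, -, rfl⟩; exact norm_nonneg _⟩ ⟨z, hz, rfl⟩
    · rw [norm_smul, Real.norm_of_nonneg hlam0]
      exact mul_le_of_le_one_right hlam0 hx1

lemma mul_resNormGen_image_le {C : Set (Euc m)} {D : Set (Euc n)} (hC : 0 ∈ C) (hD : 0 ∈ D)
    (T : Matrix (Fin l) (Fin m) ℝ) (U : Matrix (Fin p) (Fin n) ℝ) {a b : ℝ}
    (ha : 0 ≤ a) (hb : 0 ≤ b)
    (hT : ∀ x ∈ C, ‖mulE T x‖ ≤ 1 → ∃ x' ∈ C, ‖x'‖ ≤ 1 ∧ mulE T x' = a • mulE T x)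
    (hU : ∀ y ∈ D, ‖mulE U y‖ ≤ 1 → ∃ y' ∈ D, ‖y'‖ ≤ 1 ∧ mulE U y' = b • mulE U y)
    (B : Matrix (Fin p) (Fin l) ℝ) :
    a * b * resNormGen (mulE T '' C) (mulE U '' D) B
      ≤ resNormGen C D (U.transpose * B * T) := by
  have hT0 : (0 : Euc l) ∈ mulE T '' C := ⟨0, hC, mulE_zero T⟩
  have hU0 : (0 : Euc p) ∈ mulE U '' D := ⟨0, hD, mulE_zero U⟩
  have hnn := resNormGen_nonneg hC hD (U.transpose * B * T)
  rcases (mul_nonneg ha hb).eq_or_lt with h | h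
  · rw [← h, zero_mul]
    exact hnn
  rw [← le_div_iff₀' h]
  refine resNormGen_le hT0 hU0 ?_
  rintro _ ⟨x, hx, rfl⟩ hx1 _ ⟨y, hy, rfl⟩ hy1
  obtain ⟨x', hx', hx1', hxe⟩ := hT x hx hx1
  obtain ⟨y', hy', hy1', hye⟩ := hU y hy hy1
  rw [le_div_iff₀' h]
  have := inner_le_resNormGen (U.transpose * B * T) hx' hx1' hy' hy1'
  rw [mulE_mul, mulE_mul, inner_mulE, Matrix.transpose_transpose, hxe, hye, mulE_smul,
    real_inner_smul_left, real_inner_smul_right, ← mul_assoc] at this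
  exact this

end Cones

section MatrixGaussian

variable {m n l p : ℕ}

/-- The space of `n × m` matrices with the Frobenius inner product, as an `ℓ²` sum of rows. -/
abbrev RowSpace (n m : ℕ) : Type := PiLp 2 fun _ : Fin n => Euc m

/-- The matrix with given rows. -/
def toMat (v : RowSpace n m) : Matrix (Fin n) (Fin m) ℝ := Matrix.of fun i j => v i j

/-- The family of rows of a matrix. -/
def ofMat (A : Matrix (Fin n) (Fin m) ℝ) : RowSpace n m :=
  WithLp.toLp 2 fun i => WithLp.toLp 2 (A i)

lemma norm_sq_eq_sum (v : RowSpace n m) : ‖v‖ ^ 2 = ∑ i, ∑ j, toMat v i j ^ 2 := by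
  simp [PiLp.norm_sq_eq_of_L2, toMat]

lemma norm_ofMat_sq (A : Matrix (Fin n) (Fin m) ℝ) : ‖ofMat A‖ ^ 2 = ∑ i, ∑ j, A i j ^ 2 :=
  norm_sq_eq_sum _

lemma norm_ofMat_transpose (A : Matrix (Fin n) (Fin m) ℝ) : ‖ofMat A.transpose‖ = ‖ofMat A‖ := by
  rw [← sq_eq_sq₀ (norm_nonneg _) (norm_nonneg _), norm_ofMat_sq, norm_ofMat_sq, Finset.sum_comm]
  rfl

lemma norm_ofMat_mul_le (A : Matrix (Fin n) (Fin l) ℝ) (T : Matrix (Fin l) (Fin m) ℝ) :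
    ‖ofMat (A * T)‖ ≤ opNorm T * ‖ofMat A‖ := by
  refine le_of_sq_le_sq ?_ (mul_nonneg (opNorm_nonneg T) (norm_nonneg _))
  rw [mul_pow, PiLp.norm_sq_eq_of_L2, PiLp.norm_sq_eq_of_L2, Finset.mul_sum]
  refine Finset.sum_le_sum fun i _ => ?_
  have h : ofMat (A * T) i = mulE T.transpose (ofMat A i) := by
    ext j
    simp [ofMat, mulE, Matrix.mul_apply, Matrix.toLpLin_apply, Matrix.mulVec, dotProduct, mul_comm]
  rw [h, ← mul_pow]
  exact pow_le_pow_left₀ (norm_nonneg _) (norm_mulE_transpose_le T _) 2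

lemma norm_ofMat_transpose_mul_le (U : Matrix (Fin p) (Fin n) ℝ) (A : Matrix (Fin p) (Fin m) ℝ) :
    ‖ofMat (U.transpose * A)‖ ≤ opNorm U * ‖ofMat A‖ := by
  rw [← norm_ofMat_transpose, Matrix.transpose_mul, Matrix.transpose_transpose,
    ← norm_ofMat_transpose A]
  exact norm_ofMat_mul_le _ _

lemma toMat_add (v w : RowSpace n m) : toMat (v + w) = toMat v + toMat w := rfl

lemma toMat_smul (a : ℝ) (v : RowSpace n m) : toMat (a • v) = a • toMat v := rfl

lemma ofMat_add (A B : Matrix (Fin n) (Fin m) ℝ) : ofMat (A + B) = ofMat A + ofMat B := rfl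

lemma ofMat_smul (a : ℝ) (A : Matrix (Fin n) (Fin m) ℝ) : ofMat (a • A) = a • ofMat A := rfl

/-- The linear map `B ↦ Uᵀ B T` on matrices with the Frobenius norm. -/
def sandwichLin (T : Matrix (Fin l) (Fin m) ℝ) (U : Matrix (Fin p) (Fin n) ℝ) :
    RowSpace p l →ₗ[ℝ] RowSpace n m where
  toFun v := ofMat (U.transpose * toMat v * T)
  map_add' v w := by rw [toMat_add, Matrix.mul_add, Matrix.add_mul, ofMat_add]
  map_smul' a v := by
    rw [toMat_smul, Matrix.mul_smul, Matrix.smul_mul, ofMat_smul, RingHom.id_apply]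

lemma norm_sandwichLin_le (T : Matrix (Fin l) (Fin m) ℝ) (U : Matrix (Fin p) (Fin n) ℝ)
    (v : RowSpace p l) : ‖sandwichLin T U v‖ ≤ opNorm T * opNorm U * ‖v‖ := by
  calc ‖sandwichLin T U v‖ ≤ opNorm T * ‖ofMat (U.transpose * toMat v)‖ := norm_ofMat_mul_le _ _
    _ ≤ opNorm T * (opNorm U * ‖ofMat (toMat v)‖) := by
      gcongr
      · exact opNorm_nonneg T
      · exact norm_ofMat_transpose_mul_le _ _
    _ = opNorm T * opNorm U * ‖v‖ := by rw [mul_assoc]; rfl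

/-- The continuous linear map `B ↦ Uᵀ B T` on matrices with the Frobenius norm. -/
def sandwich (T : Matrix (Fin l) (Fin m) ℝ) (U : Matrix (Fin p) (Fin n) ℝ) :
    RowSpace p l →L[ℝ] RowSpace n m :=
  (sandwichLin T U).mkContinuous (opNorm T * opNorm U) (norm_sandwichLin_le T U)

lemma toMat_sandwich (T : Matrix (Fin l) (Fin m) ℝ) (U : Matrix (Fin p) (Fin n) ℝ)
    (v : RowSpace p l) : toMat (sandwich T U v) = U.transpose * toMat v * T := rfl

lemma norm_sandwich_le (T : Matrix (Fin l) (Fin m) ℝ) (U : Matrix (Fin p) (Fin n) ℝ)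
    (v : RowSpace p l) : ‖sandwich T U v‖ ≤ opNorm T * opNorm U * ‖v‖ :=
  norm_sandwichLin_le T U v

lemma norm_mulE_toMat_le (v : RowSpace n m) (x : Euc m) : ‖mulE (toMat v) x‖ ≤ ‖v‖ * ‖x‖ := by
  refine le_of_sq_le_sq ?_ (by positivity)
  rw [mul_pow, EuclideanSpace.real_norm_sq_eq, PiLp.norm_sq_eq_of_L2, Finset.sum_mul]
  refine Finset.sum_le_sum fun i _ => ?_
  have h : mulE (toMat v) x i = ⟪v i, x⟫_ℝ := by
    simp [toMat, mulE, Matrix.toLpLin_apply, Matrix.mulVec, dotProduct, PiLp.inner_apply, mul_comm]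
  rw [h, ← mul_pow, ← sq_abs]
  exact pow_le_pow_left₀ (abs_nonneg _) (abs_real_inner_le_norm _ _) 2

lemma resNormGen_toMat_le {K : Set (Euc m)} {K' : Set (Euc n)} (hK : 0 ∈ K) (hK' : 0 ∈ K')
    (v : RowSpace n m) : resNormGen K K' (toMat v) ≤ ‖v‖ := by
  refine resNormGen_le hK hK' fun x _ hx1 y _ hy1 => ?_
  calc ⟪mulE (toMat v) x, y⟫_ℝ ≤ ‖mulE (toMat v) x‖ * ‖y‖ := real_inner_le_norm _ _
    _ ≤ (‖v‖ * 1) * 1 := by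
      gcongr
      exact (norm_mulE_toMat_le v x).trans (by gcongr)
    _ = ‖v‖ := by ring

lemma convexOn_resNormGen_rpow {K : Set (Euc m)} {K' : Set (Euc n)} (hK : 0 ∈ K) (hK' : 0 ∈ K')
    {r : ℝ} (hr : 1 ≤ r) :
    ConvexOn ℝ univ fun v : RowSpace n m => resNormGen K K' (toMat v) ^ r := by
  refine ⟨convex_univ, fun v _ w _ a b ha hb hab => ?_⟩
  have hv := resNormGen_nonneg hK hK' (toMat v)
  have hw := resNormGen_nonneg hK hK' (toMat w)
  have h1 : resNormGen K K' (toMat (a • v + b • w))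
      ≤ a * resNormGen K K' (toMat v) + b * resNormGen K K' (toMat w) :=
    resNormGen_add_smul_le hK hK' _ _ ha hb
  exact (Real.rpow_le_rpow (resNormGen_nonneg hK hK' _) h1 (by linarith)).trans
    ((convexOn_rpow hr).2 hv hw ha hb hab)

lemma integrable_stdGaussian_of_le_rpow {E : Type*} [NormedAddCommGroup E]
    [InnerProductSpace ℝ E] [FiniteDimensional ℝ E] [MeasurableSpace E] [BorelSpace E]
    {g : E → ℝ} (hg : Continuous g) {r c : ℝ} (hr : 0 < r) (hc : 0 ≤ c)
    (h0 : ∀ x, 0 ≤ g x) (h : ∀ x, g x ≤ (c * ‖x‖) ^ r) : Integrable g (stdGaussian E) := by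
  have h1 : Integrable (fun x : E => ‖x‖ ^ r) (stdGaussian E) := by
    have := (IsGaussian.memLp_id (stdGaussian E) (ENNReal.ofReal r)
      ENNReal.ofReal_ne_top).integrable_norm_rpow (by simpa using hr) ENNReal.ofReal_ne_top
    simpa [ENNReal.toReal_ofReal hr.le] using this
  refine (h1.const_mul (c ^ r)).mono' hg.aestronglyMeasurable (Filter.Eventually.of_forall ?_)
  intro x
  rw [Real.norm_of_nonneg (h0 x), ← Real.mul_rpow hc (norm_nonneg x)]
  exact h x

lemma stdGaussian_rowSpace (n m : ℕ) :
    stdGaussian (RowSpace n m) = (stdGaussianPi n m).map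
      (((MeasurableEquiv.piCongrRight fun _ : Fin n => MeasurableEquiv.toLp 2 (Fin m → ℝ)).trans
        (MeasurableEquiv.toLp 2 (Fin n → Euc m)))) := by
  have h1 : (Measure.pi fun _ : Fin n => stdGaussian (Euc m)).map (WithLp.toLp 2)
      = stdGaussian (RowSpace n m) := by
    apply Measure.ext_of_charFun
    ext t
    simp_rw [charFun_pi, charFun_stdGaussian, ← Complex.exp_sum, ← Complex.ofReal_pow]
    rw [PiLp.norm_sq_eq_of_L2]
    simp [Finset.sum_div, neg_div]
  have h2 : (stdGaussianPi n m).map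
      (MeasurableEquiv.piCongrRight fun _ : Fin n => MeasurableEquiv.toLp 2 (Fin m → ℝ))
      = Measure.pi fun _ : Fin n => stdGaussian (Euc m) := by
    simp_rw [← map_pi_eq_stdGaussian]
    exact Measure.pi_map_pi (fun _ => by fun_prop)
  rw [← h1, ← h2, Measure.map_map (by fun_prop) (MeasurableEquiv.measurable _)]
  rfl

lemma integral_stdGaussianPi (φ : Matrix (Fin n) (Fin m) ℝ → ℝ) :
    ∫ G, φ (Matrix.of G) ∂(stdGaussianPi n m)
      = ∫ v, φ (toMat v) ∂(stdGaussian (RowSpace n m)) := by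
  rw [stdGaussian_rowSpace, integral_map_equiv]
  rfl

end MatrixGaussian

/-- For nonzero closed convex cones `C`, `D`, matrices `T ∈ ℝ^{ℓ×m}`,
`U ∈ ℝ^{p×n}`, `r ≥ 1`, and standard Gaussian matrices `G̃ ∈ ℝ^{p×ℓ}`, `G ∈ ℝ^{n×m}`:
`λ_T^r λ_U^r E[‖G̃‖_{TC→UD}^r] ≤ ‖T‖^r ‖U‖^r E[‖G‖_{C→D}^r]`. -/
theorem statement17 {m n l p : ℕ} (C : Set (Euc m)) (D : Set (Euc n))
    (hC : IsClosedConvexCone C) (hCne : C ≠ {0})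
    (hD : IsClosedConvexCone D) (hDne : D ≠ {0})
    (T : Matrix (Fin l) (Fin m) ℝ) (U : Matrix (Fin p) (Fin n) ℝ)
    (r : ℝ) (hr : 1 ≤ r) (lamT lamU : ℝ)
    (hlamT : lamT = max (sInf ((fun x => ‖mulE T x‖) '' (C ∩ sphere (0 : Euc m) 1)))
        (sInf ((fun z => ‖metricProj C (mulE T.transpose z)‖) '' sphere (0 : Euc l) 1)))
    (hlamU : lamU = max (sInf ((fun y => ‖mulE U y‖) '' (D ∩ sphere (0 : Euc n) 1)))
        (sInf ((fun z => ‖metricProj D (mulE U.transpose z)‖) '' sphere (0 : Euc p) 1))) :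
    lamT ^ r * lamU ^ r *
        ∫ G, (resNormGen (mulE T '' C) (mulE U '' D) (Matrix.of G)) ^ r ∂(stdGaussianPi p l)
      ≤ opNorm T ^ r * opNorm U ^ r *
          ∫ G, (resNorm C D (Matrix.of G)) ^ r ∂(stdGaussianPi n m) := by
  obtain ⟨hT0, hT⟩ := exists_mulE_eq_smul hC T hlamT
  obtain ⟨hU0, hU⟩ := exists_mulE_eq_smul hD U hlamU
  have hC0 : (0 : Euc m) ∈ C := hC.2.2.2
  have hD0 : (0 : Euc n) ∈ D := hD.2.2.2
  have hr0 : 0 < r := by linarith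
  set c := opNorm T * opNorm U
  have hc : 0 ≤ c := mul_nonneg (opNorm_nonneg T) (opNorm_nonneg U)
  let f : RowSpace n m → ℝ := fun v => resNormGen C D (toMat v) ^ r
  have hfconv : ConvexOn ℝ univ f := convexOn_resNormGen_rpow hC0 hD0 hr
  have hfcont : Continuous f := hfconv.locallyLipschitz.continuous
  have hf0 : ∀ v, 0 ≤ f v := fun v => Real.rpow_nonneg (resNormGen_nonneg hC0 hD0 _) r
  have hfle : ∀ v, f v ≤ ‖v‖ ^ r := fun v =>
    Real.rpow_le_rpow (resNormGen_nonneg hC0 hD0 _) (resNormGen_toMat_le hC0 hD0 v) hr0.le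
  have hIL : Integrable (fun v => f (sandwich T U v)) (stdGaussian (RowSpace p l)) :=
    integrable_stdGaussian_of_le_rpow (hfcont.comp (sandwich T U).continuous) hr0 hc
      (fun v => hf0 _) fun v => (hfle _).trans
        (Real.rpow_le_rpow (norm_nonneg _) (norm_sandwich_le T U v) hr0.le)
  have hIc : Integrable (fun v => f (c • v)) (stdGaussian (RowSpace n m)) :=
    integrable_stdGaussian_of_le_rpow (hfcont.comp (continuous_const_smul c)) hr0 hc
      (fun v => hf0 _) fun v => (hfle _).trans
        (by rw [norm_smul, Real.norm_of_nonneg hc])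
  have hI : Integrable f (stdGaussian (RowSpace n m)) :=
    integrable_stdGaussian_of_le_rpow hfcont hr0 zero_le_one hf0 (by simpa using hfle)
  have hconvex := integral_comp_stdGaussian_le (sandwich T U) c (norm_sandwich_le T U) hc f hfconv
    hfcont hIc hIL
  simp_rw [resNorm_eq_resNormGen hC hD]
  rw [integral_stdGaussianPi fun G => resNormGen (mulE T '' C) (mulE U '' D) G ^ r,
    integral_stdGaussianPi fun G => resNormGen C D G ^ r,
    ← Real.mul_rpow hT0 hU0, ← Real.mul_rpow (opNorm_nonneg T) (opNorm_nonneg U),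
    ← integral_const_mul, ← integral_const_mul]
  have hTC0 : (0 : Euc l) ∈ mulE T '' C := ⟨0, hC0, mulE_zero T⟩
  have hUD0 : (0 : Euc p) ∈ mulE U '' D := ⟨0, hD0, mulE_zero U⟩
  have hn : ∀ v : RowSpace p l, 0 ≤ resNormGen (mulE T '' C) (mulE U '' D) (toMat v) := fun v =>
    resNormGen_nonneg hTC0 hUD0 _
  calc ∫ v, (lamT * lamU) ^ r * resNormGen (mulE T '' C) (mulE U '' D) (toMat v) ^ r
        ∂(stdGaussian (RowSpace p l))
      ≤ ∫ v, f (sandwich T U v) ∂(stdGaussian (RowSpace p l)) := by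
        refine integral_mono_of_nonneg (Filter.Eventually.of_forall fun v => ?_) hIL
          (Filter.Eventually.of_forall fun v => ?_)
        · exact mul_nonneg (Real.rpow_nonneg (mul_nonneg hT0 hU0) r) (Real.rpow_nonneg (hn v) r)
        · have h := mul_resNormGen_image_le hC0 hD0 T U hT0 hU0 hT hU (toMat v)
          simp only [f, toMat_sandwich]
          rw [← Real.mul_rpow (mul_nonneg hT0 hU0) (hn v)]
          exact Real.rpow_le_rpow (mul_nonneg (mul_nonneg hT0 hU0) (hn v)) h hr0.le
    _ ≤ ∫ v, f (c • v) ∂(stdGaussian (RowSpace n m)) := hconvex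
    _ ≤ ∫ v, c ^ r * f v ∂(stdGaussian (RowSpace n m)) := by
        refine integral_mono hIc (hI.const_mul _) fun v => ?_
        simp only [f]
        rw [← Real.mul_rpow hc (resNormGen_nonneg hC0 hD0 _)]
        exact Real.rpow_le_rpow (resNormGen_nonneg hC0 hD0 _)
          (resNormGen_smul_le hC0 hD0 (toMat v) hc) hr0.le

end
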